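/- There exist i₀ ≥ 1 and a constant C ≥ 1 such that for all i ≥ i₀, writing Q = P_1·P_3·⋯·P_{2i−1}: for any two indices j, j' ∈ {1,2,3,4,5,7} one has ‖Q e_j‖ ≤ C·‖Q e_{j'}‖, and for any two indices j, j' ∈ {6,8,9} one has ‖Q e_j‖ ≤ C·‖Q e_{j'}‖, where ‖·‖ is the Euclidean norm on ℝ⁹ (i.e., the lengths of the column vectors of Q within each of the two groups are pairwise comparable). -/

import Mathlib

open Filter Finset Matrix

/-- The golden ratio φ = (1+√5)/2. -/
noncomputable def goldphi : ℝ := (1 + Real.sqrt 5) / 2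

/-- The matrix `A`: identity in rows 1–7, row 8 = (0,0,0,0,0,1,1,1,1),
row 9 = (0,0,0,1,1,2,0,1,2). -/
def Amat : Matrix (Fin 9) (Fin 9) ℝ :=
  !![1,0,0,0,0,0,0,0,0;
     0,1,0,0,0,0,0,0,0;
     0,0,1,0,0,0,0,0,0;
     0,0,0,1,0,0,0,0,0;
     0,0,0,0,1,0,0,0,0;
     0,0,0,0,0,1,0,0,0;
     0,0,0,0,0,0,1,0,0;
     0,0,0,0,0,1,1,1,1;
     0,0,0,1,1,2,0,1,2]

/-- The matrix `M` with rows e₆, e₉, e₈, e₂, e₄+e₅, e₇, e₁+e₃, e₃, e₄. -/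
def Mmat : Matrix (Fin 9) (Fin 9) ℝ :=
  !![0,0,0,0,0,1,0,0,0;
     0,0,0,0,0,0,0,0,1;
     0,0,0,0,0,0,0,1,0;
     0,1,0,0,0,0,0,0,0;
     0,0,0,1,1,0,0,0,0;
     0,0,0,0,0,0,1,0,0;
     1,0,1,0,0,0,0,0,0;
     0,0,1,0,0,0,0,0,0;
     0,0,0,1,0,0,0,0,0]

/-- The rank-one limit matrix `L`, nonzero only in rows 2 and 3. -/
noncomputable def Lmat : Matrix (Fin 9) (Fin 9) ℝ :=
  !![0,0,0,0,0,0,0,0,0;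
     (Real.sqrt 5 - 1)/4, 1/2, (1 + Real.sqrt 5)/4, (3 + Real.sqrt 5)/4, 1/2, 0, (3 + Real.sqrt 5)/4, 0, 0;
     (3 - Real.sqrt 5)/4, (Real.sqrt 5 - 1)/4, 1/2, (1 + Real.sqrt 5)/4, (Real.sqrt 5 - 1)/4, 0, (1 + Real.sqrt 5)/4, 0, 0;
     0,0,0,0,0,0,0,0,0;
     0,0,0,0,0,0,0,0,0;
     0,0,0,0,0,0,0,0,0;
     0,0,0,0,0,0,0,0,0;
     0,0,0,0,0,0,0,0,0;
     0,0,0,0,0,0,0,0,0]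

/-- `a_i = r_i - 1`. -/
def aseq (r : ℕ → ℕ) (i : ℕ) : ℕ := r i - 1

/-- `c_i = (2/√5)·φ^{2 a_i}`. -/
noncomputable def cseq (r : ℕ → ℕ) (i : ℕ) : ℝ :=
  (2 / Real.sqrt 5) * goldphi ^ (2 * aseq r i)

/-- `P_i = A^{a_i} M A^{a_{i+1}} M`. -/
noncomputable def Pmat (r : ℕ → ℕ) (i : ℕ) : Matrix (Fin 9) (Fin 9) ℝ :=
  Amat ^ (aseq r i) * Mmat * Amat ^ (aseq r (i+1)) * Mmat

/-- `R_i = P_i / c_{i+1}`. -/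
noncomputable def Rmat (r : ℕ → ℕ) (i : ℕ) : Matrix (Fin 9) (Fin 9) ℝ :=
  (cseq r (i+1))⁻¹ • Pmat r i

/-- The Frobenius norm of a square real matrix. -/
noncomputable def frobNorm {n : ℕ} (X : Matrix (Fin n) (Fin n) ℝ) : ℝ :=
  Real.sqrt (∑ i, ∑ j, (X i j)^2)

/-- The hypotheses on the sequence `r`: `r 1 = 1`, `r 2 = 2`, and the sequence of
differences `n ↦ r (n+1) - r n` (for `n ≥ 1`) is strictly increasing. -/
def GoodSeq (r : ℕ → ℕ) : Prop :=
  r 1 = 1 ∧ r 2 = 2 ∧ ∀ n, 1 ≤ n → r (n+1) - r n < r (n+2) - r (n+1)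

/-- The Euclidean norm on ℝ⁹. -/
noncomputable def eNorm (u : Fin 9 → ℝ) : ℝ := Real.sqrt (∑ k, (u k)^2)


lemma vecMul_A (x : Fin 9 → ℝ) : x ᵥ* Amat =
    ![x 0, x 1, x 2, x 3 + x 8, x 4 + x 8, x 5 + x 7 + 2 * x 8, x 6 + x 7, x 7 + x 8,
      x 7 + 2 * x 8] := by
  funext j
  fin_cases j <;> simp [Amat, Matrix.vecMul, dotProduct, Fin.sum_univ_succ] <;>
    (try simp [Fin.succ]) <;> (try ring)

lemma vecMul_M (x : Fin 9 → ℝ) : x ᵥ* Mmat =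
    ![x 6, x 3, x 6 + x 7, x 4 + x 8, x 4, x 0, x 5, x 2, x 1] := by
  funext j
  fin_cases j <;> simp [Mmat, Matrix.vecMul, dotProduct, Fin.sum_univ_succ]

/-- the pair (F_{2n}, F_{2n+1}) -/
def fg : ℕ → ℝ × ℝ
  | 0 => (0, 1)
  | n + 1 => ((fg n).1 + (fg n).2, (fg n).1 + 2 * (fg n).2)

/-- Explicit form of `x A^n`. -/
def powVec (x : Fin 9 → ℝ) (f g : ℝ) : Fin 9 → ℝ :=
  ![x 0, x 1, x 2,
    x 3 + ((g - f) * x 7 + f * x 8 - x 7),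
    x 4 + ((g - f) * x 7 + f * x 8 - x 7),
    x 5 + (g * x 7 + (f + g) * x 8 - x 7 - x 8),
    x 6 + ((2 * f - g) * x 7 + (g - f) * x 8 - x 8 + x 7),
    (g - f) * x 7 + f * x 8,
    f * x 7 + g * x 8]

lemma vecMul_A_pow (x : Fin 9 → ℝ) (n : ℕ) :
    x ᵥ* (Amat ^ n) = powVec x (fg n).1 (fg n).2 := by
  induction n with
  | zero =>
    funext j
    fin_cases j <;> simp [powVec, fg]
  | succ n ih =>
    rw [pow_succ, ← Matrix.vecMul_vecMul, ih, vecMul_A]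
    funext j
    fin_cases j <;> simp [powVec, fg] <;> ring

lemma fg_nonneg (n : ℕ) : 0 ≤ (fg n).1 ∧ 1 ≤ (fg n).2 := by
  induction n with
  | zero => simp [fg]
  | succ n ih => simp only [fg]; constructor <;> linarith [ih.1, ih.2]

lemma fg_bounds (n : ℕ) : 8 ≤ (fg (n + 3)).1 ∧ 3 / 2 * (fg (n + 3)).1 ≤ (fg (n + 3)).2 ∧
    (fg (n + 3)).2 ≤ 5 / 3 * (fg (n + 3)).1 := by
  induction n with
  | zero => norm_num [fg]
  | succ n ih =>
    obtain ⟨h1, h2, h3⟩ := ih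
    rw [show n + 1 + 3 = (n + 3) + 1 by ring, fg]
    refine ⟨?_, ?_, ?_⟩ <;> linarith

lemma fg_growth (a k : ℕ) : (k : ℝ) * (fg a).2 ≤ (fg (a + k)).1 ∧ (fg a).2 ≤ (fg (a + k)).2 := by
  induction k with
  | zero => simpa using (fg_nonneg a).1
  | succ k ih =>
    rw [← add_assoc, fg]
    have := fg_nonneg (a + k)
    push_cast
    constructor <;> linarith [ih.1, ih.2, this.1, this.2]

/-- One step. -/
def stepVec (x : Fin 9 → ℝ) (f g f' g' : ℝ) : Fin 9 → ℝ :=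
  powVec (powVec x f g ᵥ* Mmat) f' g' ᵥ* Mmat

lemma vecMul_P (x : Fin 9 → ℝ) (r : ℕ → ℕ) (i : ℕ) :
    x ᵥ* Pmat r i = stepVec x (fg (aseq r i)).1 (fg (aseq r i)).2
      (fg (aseq r (i+1))).1 (fg (aseq r (i+1))).2 := by
  simp only [Pmat, stepVec, ← Matrix.vecMul_vecMul, vecMul_A_pow]

/-- First group of indices. -/
def G1 : Finset (Fin 9) := {0,1,2,3,4,6}
/-- Second group of indices. -/
def G2 : Finset (Fin 9) := {5,7,8}

set_option maxHeartbeats 4000000 in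
lemma step_upper (x : Fin 9 → ℝ) (f g f' g' D : ℝ) (hx : ∀ j, 0 < x j)
    (hf : 8 ≤ f) (h1 : 3 / 2 * f ≤ g) (h2 : g ≤ 5 / 3 * f)
    (hf' : 8 ≤ f') (h1' : 3 / 2 * f' ≤ g') (h2' : g' ≤ 5 / 3 * f')
    (hN : 160 * g ≤ f') (hD : 80 ≤ D)
    (hJ : ∀ j, ∀ k ∈ G1, x j ≤ D * x k) :
    ∀ j, stepVec x f g f' g' j ≤ D * (f' / 4 * (x 1 + x 2)) := by
  have hb : ∀ j, x j ≤ D / 2 * (x 1 + x 2) := fun j => by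
    have := hJ j 1 (by decide)
    have := hJ j 2 (by decide)
    linarith
  set m := x 1 + x 2 with hm
  have hm0 : 0 < m := by have := hx 1; have := hx 2; linarith
  set B := D / 2 * m with hB
  have hB0 : 0 < B := by positivity
  have hgB : 160 * (g * B) ≤ f' * B := by nlinarith
  have hfB : f * B ≤ g * B := by nlinarith
  have h8B : 8 * B ≤ f * B := by nlinarith
  have hfm : 0 < f' * m := by positivity
  have hDfm : f' * B = D / 2 * (f' * m) := by rw [hB]; ring
  have hDfm2 : 80 * (f' * m) ≤ D * (f' * m) := by nlinarith
  have e : D * (f' / 4 * m) = D * (f' * m) / 4 := by ring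
  have f7 : f * x 7 ≤ f * B := by nlinarith [hb 7]
  have f8 : f * x 8 ≤ f * B := by nlinarith [hb 8]
  have g7 : g * x 7 ≤ g * B := by nlinarith [hb 7]
  have g8 : g * x 8 ≤ g * B := by nlinarith [hb 8]
  have f70 : 0 ≤ f * x 7 := by nlinarith [hx 7]
  have f80 : 0 ≤ f * x 8 := by nlinarith [hx 8]
  have g70 : 0 ≤ g * x 7 := by nlinarith [hx 7]
  have g80 : 0 ≤ g * x 8 := by nlinarith [hx 8]
  have p1 : 0 ≤ f' * x 1 := by nlinarith [hx 1]
  have p2 : 0 ≤ f' * x 2 := by nlinarith [hx 2]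
  have p3 : f' * m = f' * x 1 + f' * x 2 := by rw [hm]; ring
  have q1 : g' * x 1 ≤ 5 / 3 * (f' * x 1) := by nlinarith [hx 1]
  have q2 : g' * x 2 ≤ 5 / 3 * (f' * x 2) := by nlinarith [hx 2]
  have q10 : 0 ≤ g' * x 1 := by nlinarith [hx 1]
  have q20 : 0 ≤ g' * x 2 := by nlinarith [hx 2]
  have b0 := hb 0
  have b1 := hb 1
  have b2 := hb 2
  have b3 := hb 3
  have b4 := hb 4
  have b5 := hb 5
  have b6 := hb 6
  have b7 := hb 7
  have b8 := hb 8
  have c1 := hx 1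
  have c2 := hx 2
  have c7 := hx 7
  have c8 := hx 8
  rw [e]
  intro j
  fin_cases j <;> simp [stepVec, vecMul_M, powVec] <;> linarith

lemma step_lower (x : Fin 9 → ℝ) (f g f' g' : ℝ) (hx : ∀ j, 0 < x j)
    (hf : 8 ≤ f) (h1 : 3 / 2 * f ≤ g) (h2 : g ≤ 5 / 3 * f)
    (hf' : 8 ≤ f') (h1' : 3 / 2 * f' ≤ g') (h2' : g' ≤ 5 / 3 * f') :
    ∀ k ∈ G1, f' / 4 * (x 1 + x 2) ≤ stepVec x f g f' g' k := by
  have c0 := hx 0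
  have c1 := hx 1
  have c2 := hx 2
  have c3 := hx 3
  have c4 := hx 4
  have c5 := hx 5
  have c6 := hx 6
  have c7 := hx 7
  have c8 := hx 8
  have g7 : 3 / 2 * (f * x 7) ≤ g * x 7 := by nlinarith
  have g8 : 3 / 2 * (f * x 8) ≤ g * x 8 := by nlinarith
  have f7 : 8 * x 7 ≤ f * x 7 := by nlinarith
  have f8 : 8 * x 8 ≤ f * x 8 := by nlinarith
  have p1 : 8 * x 1 ≤ f' * x 1 := by nlinarith
  have p2 : 8 * x 2 ≤ f' * x 2 := by nlinarith
  have q1 : 3 / 2 * (f' * x 1) ≤ g' * x 1 := by nlinarith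
  have q2 : 3 / 2 * (f' * x 2) ≤ g' * x 2 := by nlinarith
  have q1' : g' * x 1 ≤ 5 / 3 * (f' * x 1) := by nlinarith
  have q2' : g' * x 2 ≤ 5 / 3 * (f' * x 2) := by nlinarith
  intro k hk
  simp only [G1, Finset.mem_insert, Finset.mem_singleton] at hk
  rcases hk with rfl | rfl | rfl | rfl | rfl | rfl <;> simp [stepVec, vecMul_M, powVec] <;> linarith

lemma step_two (x : Fin 9 → ℝ) (f g f' g' D E : ℝ) (hx : ∀ j, 0 < x j)
    (hf : 8 ≤ f) (h1 : 3 / 2 * f ≤ g) (h2 : g ≤ 5 / 3 * f)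
    (hE : 16 ≤ E) (hDE : D ≤ E)
    (hJ : ∀ j, ∀ k ∈ G1, x j ≤ D * x k) :
    ∀ j ∈ G2, ∀ k ∈ G2, stepVec x f g f' g' j ≤ E * stepVec x f g f' g' k := by
  have c3 := hx 3
  have c6 := hx 6
  have c7 := hx 7
  have c8 := hx 8
  have j36 : x 3 ≤ E * x 6 := by have := hJ 3 6 (by decide); nlinarith
  have j63 : x 6 ≤ E * x 3 := by have := hJ 6 3 (by decide); nlinarith
  have e3 : x 3 ≤ E * x 3 := by nlinarith
  have e6 : x 6 ≤ E * x 6 := by nlinarith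
  have g7 : 3 / 2 * (f * x 7) ≤ g * x 7 := by nlinarith
  have g8 : 3 / 2 * (f * x 8) ≤ g * x 8 := by nlinarith
  have g7' : g * x 7 ≤ 5 / 3 * (f * x 7) := by nlinarith
  have g8' : g * x 8 ≤ 5 / 3 * (f * x 8) := by nlinarith
  have f7 : 8 * x 7 ≤ f * x 7 := by nlinarith
  have f8 : 8 * x 8 ≤ f * x 8 := by nlinarith
  -- key quantities: all lie between `T / 4` and `4 T`
  set T := f * x 7 + f * x 8 with hT
  have hT0 : 0 < T := by linarith
  have key : ∀ y w u v : ℝ, y ≤ E * w → u ≤ 4 * T → T / 4 ≤ v → y + u ≤ E * (w + v) := by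
    intro y w u v hy hu hv
    have : 16 * v ≤ E * v := by nlinarith
    nlinarith
  have s5 : stepVec x f g f' g' 5 = x 6 + ((2 * f - g) * x 7 + (g - f) * x 8 - x 8 + x 7) := by
    simp [stepVec, vecMul_M, powVec]
  have s7 : stepVec x f g f' g' 7 = x 6 + (f * x 7 + g * x 8 - x 8 + x 7) := by
    simp [stepVec, vecMul_M, powVec]; ring
  have s8 : stepVec x f g f' g' 8 = x 3 + ((g - f) * x 7 + f * x 8 - x 7) := by
    simp [stepVec, vecMul_M, powVec]
  intro j hj k hk
  simp only [G2, Finset.mem_insert, Finset.mem_singleton] at hj hk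
  rcases hj with rfl | rfl | rfl <;> rcases hk with rfl | rfl | rfl <;>
    simp only [s5, s7, s8] <;> apply key <;> first | assumption | linarith

lemma A_pos (x : Fin 9 → ℝ) (hx : ∀ j, 0 < x j) : ∀ j, 0 < (x ᵥ* Amat) j := by
  intro j
  have h := hx
  rw [vecMul_A]
  have c3 := hx 3
  have c4 := hx 4
  have c5 := hx 5
  have c6 := hx 6
  have c7 := hx 7
  have c8 := hx 8
  fin_cases j <;> simp [hx] <;> positivity

lemma M_pos (x : Fin 9 → ℝ) (hx : ∀ j, 0 < x j) : ∀ j, 0 < (x ᵥ* Mmat) j := by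
  intro j
  rw [vecMul_M]
  have c4 := hx 4
  have c6 := hx 6
  have c7 := hx 7
  have c8 := hx 8
  fin_cases j <;> simp [hx] <;> positivity

lemma A_pow_pos (x : Fin 9 → ℝ) (hx : ∀ j, 0 < x j) (n : ℕ) :
    ∀ j, 0 < (x ᵥ* (Amat ^ n)) j := by
  induction n with
  | zero => simpa using hx
  | succ n ih => rw [pow_succ, ← Matrix.vecMul_vecMul]; exact A_pos _ ih

lemma P_pos (x : Fin 9 → ℝ) (hx : ∀ j, 0 < x j) (r : ℕ → ℕ) (i : ℕ) :
    ∀ j, 0 < (x ᵥ* Pmat r i) j := by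
  simp only [Pmat, ← Matrix.vecMul_vecMul]
  exact M_pos _ (A_pow_pos _ (M_pos _ (A_pow_pos _ hx _)) _)

lemma mul_nn {X Y : Matrix (Fin 9) (Fin 9) ℝ} (hX : ∀ i j, 0 ≤ X i j) (hY : ∀ i j, 0 ≤ Y i j) :
    ∀ i j, 0 ≤ (X * Y) i j := fun i j => by
  rw [Matrix.mul_apply]
  exact Finset.sum_nonneg fun k _ => mul_nonneg (hX i k) (hY k j)

lemma A_nn : ∀ i j, 0 ≤ Amat i j := by
  intro i j
  fin_cases i <;> fin_cases j <;> simp [Amat]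

lemma M_nn : ∀ i j, 0 ≤ Mmat i j := by
  intro i j
  fin_cases i <;> fin_cases j <;> simp [Mmat]

lemma one_nn : ∀ i j, 0 ≤ (1 : Matrix (Fin 9) (Fin 9) ℝ) i j := by
  intro i j
  rw [Matrix.one_apply]
  split_ifs <;> norm_num

lemma A_pow_nn (n : ℕ) : ∀ i j, 0 ≤ (Amat ^ n) i j := by
  induction n with
  | zero => simpa using one_nn
  | succ n ih => rw [pow_succ]; exact mul_nn ih A_nn

lemma P_nn (r : ℕ → ℕ) (i : ℕ) : ∀ k j, 0 ≤ (Pmat r i) k j :=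
  mul_nn (mul_nn (mul_nn (A_pow_nn _) M_nn) (A_pow_nn _)) M_nn

/-- the product -/
noncomputable def Qm (r : ℕ → ℕ) (i : ℕ) : Matrix (Fin 9) (Fin 9) ℝ :=
  ((List.range i).map (fun l => Pmat r (2*l+1))).prod

lemma Qm_zero (r : ℕ → ℕ) : Qm r 0 = 1 := by simp [Qm]

lemma Qm_succ (r : ℕ → ℕ) (i : ℕ) : Qm r (i+1) = Qm r i * Pmat r (2*i+1) := by
  simp [Qm, List.range_succ]

lemma Qm_nn (r : ℕ → ℕ) (i : ℕ) : ∀ k j, 0 ≤ (Qm r i) k j := by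
  induction i with
  | zero => rw [Qm_zero]; exact one_nn
  | succ i ih => rw [Qm_succ]; exact mul_nn ih (P_nn _ _)

/-- column sums -/
noncomputable def Xv (r : ℕ → ℕ) (i : ℕ) : Fin 9 → ℝ := (fun _ => (1:ℝ)) ᵥ* Qm r i

lemma Xv_succ (r : ℕ → ℕ) (i : ℕ) : Xv r (i+1) = Xv r i ᵥ* Pmat r (2*i+1) := by
  simp [Xv, Qm_succ, Matrix.vecMul_vecMul]

lemma Xv_pos (r : ℕ → ℕ) (i : ℕ) : ∀ j, 0 < Xv r i j := by
  induction i with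
  | zero => simp [Xv, Qm_zero]
  | succ i ih => rw [Xv_succ]; exact P_pos _ ih _ _

lemma Xv_apply (r : ℕ → ℕ) (i : ℕ) (j : Fin 9) : Xv r i j = ∑ k, Qm r i k j := by
  simp [Xv, Matrix.vecMul, dotProduct]

lemma eNorm_le (r : ℕ → ℕ) (i : ℕ) (j : Fin 9) :
    eNorm ((Qm r i).mulVec (Pi.single j (1 : ℝ))) ≤ Xv r i j := by
  rw [Xv_apply, eNorm]
  apply Real.sqrt_le_iff.2
  refine ⟨Finset.sum_nonneg fun k _ => Qm_nn r i k j, ?_⟩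
  simp only [Matrix.mulVec_single_one, Matrix.col_apply]
  exact Finset.sum_sq_le_sq_sum_of_nonneg fun k _ => Qm_nn r i k j

lemma le_eNorm (r : ℕ → ℕ) (i : ℕ) (j : Fin 9) :
    Xv r i j ≤ 9 * eNorm ((Qm r i).mulVec (Pi.single j (1 : ℝ))) := by
  rw [Xv_apply, eNorm]
  simp only [Matrix.mulVec_single_one, Matrix.col_apply]
  have : ∀ k ∈ (Finset.univ : Finset (Fin 9)),
      Qm r i k j ≤ Real.sqrt (∑ k, (Qm r i k j)^2) := fun k hk => by
    apply Real.le_sqrt_of_sq_le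
    exact Finset.single_le_sum (f := fun k => (Qm r i k j)^2) (fun k _ => sq_nonneg _) hk
  have h := Finset.sum_le_card_nsmul _ _ _ this
  simpa using h

lemma diff_ge (r : ℕ → ℕ) (hr : GoodSeq r) (n : ℕ) : n + 1 ≤ r (n+2) - r (n+1) := by
  obtain ⟨h1, h2, h3⟩ := hr
  induction n with
  | zero => simp [h1, h2]
  | succ n ih =>
    have h := h3 (n+1) (by omega)
    rw [show n + 1 + 2 = n + 3 from rfl, show n + 1 + 1 = n + 2 from rfl] at h ⊢
    omega

lemma r_ge (r : ℕ → ℕ) (hr : GoodSeq r) (n : ℕ) : n + 1 ≤ r (n+1) := by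
  induction n with
  | zero => simp [hr.1]
  | succ n ih =>
    have h := diff_ge r hr n
    rw [show n + 1 + 1 = n + 2 from rfl]
    omega

lemma fg_bounds' (n : ℕ) (hn : 3 ≤ n) : 8 ≤ (fg n).1 ∧ 3 / 2 * (fg n).1 ≤ (fg n).2 ∧
    (fg n).2 ≤ 5 / 3 * (fg n).1 := by
  obtain ⟨k, rfl⟩ := Nat.exists_eq_add_of_le' hn
  exact fg_bounds k

lemma seq_facts (r : ℕ → ℕ) (hr : GoodSeq r) (i : ℕ) (hi : 80 ≤ i) :
    3 ≤ aseq r (2*i+1) ∧ 3 ≤ aseq r (2*i+1+1) ∧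
    160 * (fg (aseq r (2*i+1))).2 ≤ (fg (aseq r (2*i+1+1))).1 := by
  have h1 := r_ge r hr (2*i)
  have h2 := diff_ge r hr (2*i)
  have e : aseq r (2*i+1+1) = aseq r (2*i+1) + (r (2*i+2) - r (2*i+1)) := by
    simp only [aseq]; rw [show 2*i+1+1 = 2*i+2 by ring]; omega
  refine ⟨by simp only [aseq]; omega, by rw [e]; simp only [aseq]; omega, ?_⟩
  rw [e]
  refine le_trans ?_ (fg_growth _ _).1
  have := (fg_nonneg (aseq r (2*i+1))).2
  have h : (160:ℝ) ≤ ((r (2*i+2) - r (2*i+1) : ℕ) : ℝ) := by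
    exact_mod_cast (by omega : 160 ≤ r (2*i+2) - r (2*i+1))
  nlinarith

lemma base (x : Fin 9 → ℝ) (hx : ∀ j, 0 < x j) :
    ∃ D : ℝ, 80 ≤ D ∧ ∀ j k, x j ≤ D * x k := by
  have hn : ∀ p : Fin 9 × Fin 9, 0 ≤ x p.1 / x p.2 := fun p => (div_pos (hx _) (hx _)).le
  refine ⟨80 + ∑ p : Fin 9 × Fin 9, x p.1 / x p.2, ?_, ?_⟩
  · linarith [Finset.sum_nonneg fun p (_ : p ∈ Finset.univ) => hn p]
  · intro j k
    rw [← div_le_iff₀ (hx k)]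
    have := Finset.single_le_sum (f := fun p : Fin 9 × Fin 9 => x p.1 / x p.2)
      (fun p _ => hn p) (Finset.mem_univ (j, k))
    simp only at this
    linarith

lemma invariant (r : ℕ → ℕ) (hr : GoodSeq r) : ∃ D : ℝ, 80 ≤ D ∧ ∀ n,
    (∀ j, ∀ k ∈ G1, Xv r (80 + n) j ≤ D * Xv r (80 + n) k) ∧
    (∀ j ∈ G2, ∀ k ∈ G2, Xv r (80 + n) j ≤ D * Xv r (80 + n) k) := by
  obtain ⟨D, hD, h⟩ := base _ (Xv_pos r 80)
  refine ⟨D, hD, fun n => ?_⟩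
  induction n with
  | zero => exact ⟨fun j k _ => h j k, fun j _ k _ => h j k⟩
  | succ n ih =>
    obtain ⟨a3, b3, hN⟩ := seq_facts r hr (80 + n) (by omega)
    obtain ⟨hf, h1, h2⟩ := fg_bounds' _ a3
    obtain ⟨hf', h1', h2'⟩ := fg_bounds' _ b3
    have hx := Xv_pos r (80 + n)
    rw [← add_assoc, Xv_succ, vecMul_P]
    refine ⟨fun j k hk => ?_, ?_⟩
    · refine (step_upper _ _ _ _ _ D hx hf h1 h2 hf' h1' h2' hN hD ih.1 j).trans ?_
      exact mul_le_mul_of_nonneg_left (step_lower _ _ _ _ _ hx hf h1 h2 hf' h1' h2' k hk)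
        (by linarith)
    · exact step_two _ _ _ _ _ D D hx hf h1 h2 (by linarith) le_rfl ih.1

/-- For `Q = P_1 P_3 ⋯ P_{2i−1}` with `i` sufficiently large, the lengths of the columns
of `Q` within each of the two groups of indices {1,2,3,4,5,7} and {6,8,9} (0-indexed as
{0,1,2,3,4,6} and {5,7,8}) are pairwise comparable. -/
theorem stmt14 (r : ℕ → ℕ) (hr : GoodSeq r) :
    ∃ i₀ : ℕ, 1 ≤ i₀ ∧ ∃ C : ℝ, 1 ≤ C ∧
      ∀ i : ℕ, i₀ ≤ i →
        let Q := ((List.range i).map (fun l => Pmat r (2*l+1))).prod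
        (∀ j j' : Fin 9, j ∈ ({0,1,2,3,4,6} : Finset (Fin 9)) →
            j' ∈ ({0,1,2,3,4,6} : Finset (Fin 9)) →
            eNorm (Q.mulVec (Pi.single j (1 : ℝ))) ≤ C * eNorm (Q.mulVec (Pi.single j' (1 : ℝ)))) ∧
        (∀ j j' : Fin 9, j ∈ ({5,7,8} : Finset (Fin 9)) →
            j' ∈ ({5,7,8} : Finset (Fin 9)) →
            eNorm (Q.mulVec (Pi.single j (1 : ℝ))) ≤ C * eNorm (Q.mulVec (Pi.single j' (1 : ℝ)))) := by
  obtain ⟨D, hD, h⟩ := invariant r hr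
  refine ⟨80, by norm_num, 9 * D, by linarith, fun i hi => ?_⟩
  obtain ⟨n, rfl⟩ := Nat.exists_eq_add_of_le hi
  intro Q
  have comp : ∀ j k, Xv r (80 + n) j ≤ D * Xv r (80 + n) k →
      eNorm (Q.mulVec (Pi.single j (1 : ℝ))) ≤ 9 * D * eNorm (Q.mulVec (Pi.single k (1 : ℝ))) := by
    intro j k hjk
    have h1 := eNorm_le r (80 + n) j
    have h2 := mul_le_mul_of_nonneg_left (le_eNorm r (80 + n) k) (by linarith : 0 ≤ D)
    change eNorm ((Qm r (80 + n)).mulVec _) ≤ 9 * D * eNorm ((Qm r (80 + n)).mulVec _)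
    linarith
  exact ⟨fun j k _ hk => comp j k ((h n).1 j k hk), fun j k hj hk => comp j k ((h n).2 j hj k hk)⟩
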